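/- arXiv:1512.03043 — 2 statements merged into one kernel-verified Lean document; each statement's English description precedes it below -/
import Mathlib

section
/- Let n = 2 and let Φ̃ : [0,∞) → [0,∞) be monotone nondecreasing and lower semicontinuous with Φ̃(t) = 1 for every t ≥ 2. Then there exists R_o > 0, depending only on σ, such that for every R ≥ R_o and every admissible pair (v,F) in B_R with v = ũ a.e. outside B_R, with v − ũ (extended by 0 outside B_R) having a square-integrable weak gradient on all of ℝ², and with F\B_R = Ẽ\B_R up to a set of measure zero, one has Ẽ_{B_R}(ũ,Ẽ) ≤ Ẽ_{B_R}(v,F), where Ẽ denotes the energy functional built from Φ̃. -/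
open MeasureTheory Filter Set Metric Bornology
open scoped ENNReal Topology symmDiff

noncomputable section

abbrev Pt (n : ℕ) : Type := EuclideanSpace ℝ (Fin n)

/-- The interaction functional `L(A,B) = ∫_A ∫_B |x-y|^{-(n+σ)} dy dx`. -/
def interL (n : ℕ) (σ : ℝ) (A B : Set (Pt n)) : ℝ≥0∞ :=
  ∫⁻ x in A, ∫⁻ y in B, ENNReal.ofReal (‖x - y‖ ^ (-((n : ℝ) + σ)))

/-- The fractional `σ`-perimeter of `E` in `D`. -/
def fracPer (n : ℕ) (σ : ℝ) (E D : Set (Pt n)) : ℝ≥0∞ :=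
  interL n σ (E ∩ D) Eᶜ + interL n σ (Eᶜ ∩ D) (E ∩ Dᶜ)

/-- `u` (locally integrable) has weak gradient `G` on the open set `U`. -/
def HasWeakGradOn (n : ℕ) (u : Pt n → ℝ) (G : Pt n → Pt n) (U : Set (Pt n)) : Prop :=
  LocallyIntegrableOn G U volume ∧
  ∀ (i : Fin n) (φ : Pt n → ℝ), ContDiff ℝ (⊤ : ℕ∞) φ → HasCompactSupport φ →
    tsupport φ ⊆ U →
    ∫ x, u x * fderiv ℝ φ x (EuclideanSpace.single i 1) = -∫ x, G x i * φ x

/-- The zero-extension (by `0` outside `Ω`) of `w` has a square-integrable weak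
gradient on all of `ℝⁿ`. -/
def ZeroExtGradL2 (n : ℕ) (Ω : Set (Pt n)) (w : Pt n → ℝ) : Prop :=
  ∃ H : Pt n → Pt n,
    HasWeakGradOn n (Ω.indicator w) H Set.univ ∧
    Integrable (fun x => ‖H x‖ ^ 2) volume

/-- An admissible pair `(u,E)` in `Ω`, with `G` a weak gradient of `u` on `Ω`. -/
structure AdmissiblePair (n : ℕ) (σ : ℝ) (Ω : Set (Pt n)) (u : Pt n → ℝ)
    (G : Pt n → Pt n) (E : Set (Pt n)) : Prop where
  locInt : LocallyIntegrable u volume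
  weakGrad : HasWeakGradOn n u G Ω
  dirichletFin : IntegrableOn (fun x => ‖G x‖ ^ 2) Ω volume
  measE : MeasurableSet E
  perFin : fracPer n σ E Ω ≠ ∞
  nonnegOnE : ∀ᵐ x ∂(volume : Measure (Pt n)), x ∈ E → 0 ≤ u x
  nonposOffE : ∀ᵐ x ∂(volume : Measure (Pt n)), x ∉ E → u x ≤ 0

/-- The energy functional `E_Ω(u,E)` (with `G` the weak gradient of `u` on `Ω`). -/
def energyF (n : ℕ) (σ : ℝ) (Φ : ℝ → ℝ) (Ω : Set (Pt n)) (G : Pt n → Pt n)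
    (E : Set (Pt n)) : ℝ :=
  (∫ x in Ω, ‖G x‖ ^ 2) + Φ ((fracPer n σ E Ω).toReal)

/-- `(u,E)`, with weak gradient `G`, minimizes the energy in `Ω` among admissible
competitors with the same exterior data. -/
def MinimizesIn (n : ℕ) (σ : ℝ) (Φ : ℝ → ℝ) (Ω : Set (Pt n)) (u : Pt n → ℝ)
    (G : Pt n → Pt n) (E : Set (Pt n)) : Prop :=
  AdmissiblePair n σ Ω u G E ∧
  ∀ (v : Pt n → ℝ) (Gv : Pt n → Pt n) (F : Set (Pt n)),
    AdmissiblePair n σ Ω v Gv F →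
    (∀ᵐ x ∂(volume : Measure (Pt n)), x ∉ Ω → v x = u x) →
    ZeroExtGradL2 n Ω (fun x => v x - u x) →
    volume ((F \ Ω) ∆ (E \ Ω)) = 0 →
    energyF n σ Φ Ω G E ≤ energyF n σ Φ Ω Gv F

/-- `(u,E)` is a minimal pair in `Ω`. -/
def IsMinimalPair (n : ℕ) (σ : ℝ) (Φ : ℝ → ℝ) (Ω : Set (Pt n)) (u : Pt n → ℝ)
    (E : Set (Pt n)) : Prop :=
  ∃ G : Pt n → Pt n, MinimizesIn n σ Φ Ω u G E

/-- `ũ(x,y) = xy`. -/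
def tildeU : Pt 2 → ℝ := fun p => p 0 * p 1

/-- `Ẽ = {(x,y) : xy > 0}`. -/
def tildeE : Set (Pt 2) := {p : Pt 2 | 0 < p 0 * p 1}

/-- `∇ũ(x,y) = (y,x)`. -/
def tildeG : Pt 2 → Pt 2 := fun p => (WithLp.equiv 2 (Fin 2 → ℝ)).symm ![p 1, p 0]

/-- The precise representative `û` of a locally integrable function. -/
def preciseRep (n : ℕ) (u : Pt n → ℝ) (x : Pt n) : ℝ :=
  limsup (fun ε : ℝ => (volume (ball x ε)).toReal⁻¹ * ∫ y in ball x ε, u y)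
    (𝓝[>] (0 : ℝ))

/-- Membership in the set `𝒰₀`. -/
def memU0 (n : ℕ) (Ω : Set (Pt n)) (u : Pt n → ℝ) (p : Pt n) : Prop :=
  p ∈ Ω ∧ ∃ xs : ℕ → Pt n, (∀ k, xs k ∈ Ω) ∧ Tendsto xs atTop (𝓝 p) ∧
    Tendsto (fun k => preciseRep n u (xs k)) atTop (𝓝 (0 : ℝ))

end

lemma mul_volume_le_interL {n : ℕ} {σ D : ℝ} {A B B' : Set (Pt n)} (hσ : 0 ≤ (n : ℝ) + σ)
    (hA : MeasurableSet A) (hB' : MeasurableSet B')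
    (hBB : B' ≤ᵐ[(volume : Measure (Pt n))] B)
    (hpos : ∀ x ∈ A, ∀ y ∈ B', 0 < ‖x - y‖) (hle : ∀ x ∈ A, ∀ y ∈ B', ‖x - y‖ ≤ D) :
    ENNReal.ofReal (D ^ (-((n : ℝ) + σ))) * volume B' * volume A ≤ interL n σ A B := by
  rw [← setLIntegral_const, interL]
  refine setLIntegral_mono' hA fun x hx => ?_
  rw [← setLIntegral_const]
  refine (setLIntegral_mono' hB' fun y hy => ?_).trans (lintegral_mono_set' hBB)
  exact ENNReal.ofReal_le_ofReal
    (Real.rpow_le_rpow_of_nonpos (hpos x hx y hy) (hle x hx y hy) (by linarith))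

lemma abs_sub_lt_of_mem_ball {n : ℕ} {p y : Pt n} {r : ℝ} (hy : y ∈ ball p r) (i : Fin n) :
    |y i - p i| < r := by
  have h := PiLp.norm_apply_le (y - p) i
  rw [mem_ball, dist_eq_norm] at hy
  exact lt_of_le_of_lt (by simpa using h) hy

lemma notMem_ball_zero_of_le_abs {n : ℕ} {y : Pt n} {r : ℝ} (i : Fin n) (h : r ≤ |y i|) :
    y ∉ ball (0 : Pt n) r := by
  rw [mem_ball_zero_iff, not_lt]
  exact h.trans (by simpa using PiLp.norm_apply_le y i)

/-- Balls of radius `r` centred at `(3r, ±3r)` have distance at most `7r` from points of the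
ball of radius `r` centred at the origin. -/
lemma norm_sub_le_of_mem_ball {r s : ℝ} (hr : 0 ≤ r) (hs : s ^ 2 = (3 * r) ^ 2) {x y : Pt 2}
    (hx : x ∈ ball (0 : Pt 2) r) (hy : y ∈ ball (!₂[3 * r, s] : Pt 2) r) :
    ‖x - y‖ ≤ 7 * r := by
  have hp : ‖(!₂[3 * r, s] : Pt 2)‖ ≤ 5 * r := by
    refine le_of_sq_le_sq ?_ (by positivity)
    rw [EuclideanSpace.real_norm_sq_eq, Fin.sum_univ_two]
    simp only [Matrix.cons_val_zero, Matrix.cons_val_one]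
    nlinarith [sq_nonneg r]
  rw [mem_ball_zero_iff] at hx
  rw [mem_ball, dist_eq_norm] at hy
  calc ‖x - y‖ = ‖x - (y - !₂[3 * r, s]) - !₂[3 * r, s]‖ := by congr 1; abel
    _ ≤ ‖x‖ + ‖y - !₂[3 * r, s]‖ + ‖(!₂[3 * r, s] : Pt 2)‖ :=
        (norm_sub_le _ _).trans (by gcongr; exact norm_sub_le _ _)
    _ ≤ 7 * r := by linarith

lemma two_le_rpow_mul {σ R : ℝ} (hσ : σ ∈ Set.Ioo (0 : ℝ) 1) (hR : 100 ≤ R) :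
    2 ≤ (7 * R) ^ (-(((2 : ℕ) : ℝ) + σ)) * (R ^ 2 * Real.pi) * (R ^ 2 * Real.pi) := by
  have h1 : (7 * R) ^ (-3 : ℝ) ≤ (7 * R) ^ (-(((2 : ℕ) : ℝ) + σ)) :=
    Real.rpow_le_rpow_of_exponent_le (by linarith) (by push_cast; linarith [hσ.2])
  have h2 : (7 * R) ^ (-3 : ℝ) = ((7 * R) ^ 3)⁻¹ := by
    rw [Real.rpow_neg (by linarith)]
    norm_cast
  have hpi : 9 ≤ Real.pi ^ 2 := by nlinarith [Real.pi_gt_three]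
  rw [h2] at h1
  calc (2 : ℝ) ≤ R * 9 / 343 := by linarith
    _ ≤ R * Real.pi ^ 2 / 343 := by gcongr
    _ = ((7 * R) ^ 3)⁻¹ * (R ^ 2 * Real.pi) * (R ^ 2 * Real.pi) := by
        field_simp; norm_num
    _ ≤ _ := by gcongr

lemma ofReal_two_le_fracPer {σ R : ℝ} (hσ : σ ∈ Set.Ioo (0 : ℝ) 1) (hR : 100 ≤ R)
    {F : Set (Pt 2)} (hF : MeasurableSet F)
    (hFE : volume ((F \ ball (0 : Pt 2) R) ∆ (tildeE \ ball (0 : Pt 2) R)) = 0) :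
    ENNReal.ofReal 2 ≤ fracPer 2 σ F (ball (0 : Pt 2) R) := by
  have hR0 : 0 ≤ R := by linarith
  have hout : ∀ s : ℝ, ∀ y ∈ ball (!₂[3 * R, s] : Pt 2) R,
      2 * R < y 0 ∧ |y 1 - s| < R ∧ y ∉ ball (0 : Pt 2) R := by
    intro s y hy
    have h0 := abs_sub_lt_of_mem_ball hy 0
    have h1 := abs_sub_lt_of_mem_ball hy 1
    simp only [Matrix.cons_val_zero, Matrix.cons_val_one] at h0 h1
    have h2 : 2 * R < y 0 := by linarith [(abs_lt.1 h0).1]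
    exact ⟨h2, h1, notMem_ball_zero_of_le_abs 0 (by linarith [le_abs_self (y 0)])⟩
  have hae : ∀ᵐ y ∂(volume : Measure (Pt 2)), y ∉ ball (0 : Pt 2) R → (y ∈ F ↔ y ∈ tildeE) := by
    filter_upwards [measure_eq_zero_iff_ae_notMem.1 hFE] with y hy hyB
    simp only [mem_symmDiff, Set.mem_sdiff] at hy
    tauto
  have hneg : ball (!₂[3 * R, -(3 * R)] : Pt 2) R ≤ᵐ[volume] Fᶜ := by
    filter_upwards [hae] with y hy hyb
    obtain ⟨h0, h1, h2⟩ := hout _ y hyb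
    intro hyF
    have h3 : 0 < y 0 * y 1 := (hy h2).1 hyF
    nlinarith [(abs_lt.1 h1).2]
  have hpos : ball (!₂[3 * R, 3 * R] : Pt 2) R ≤ᵐ[volume] (F ∩ (ball (0 : Pt 2) R)ᶜ : Set _) := by
    filter_upwards [hae] with y hy hyb
    obtain ⟨h0, h1, h2⟩ := hout _ y hyb
    refine ⟨(hy h2).2 ?_, h2⟩
    have : 0 < y 1 := by linarith [(abs_lt.1 h1).1]
    exact mul_pos (by linarith) this
  have hsep : ∀ s : ℝ, ∀ x ∈ ball (0 : Pt 2) R, ∀ y ∈ ball (!₂[3 * R, s] : Pt 2) R,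
      0 < ‖x - y‖ := by
    intro s x hx y hy
    rw [norm_pos_iff, sub_ne_zero]
    rintro rfl
    exact (hout s x hy).2.2 hx
  have hσ' : 0 ≤ ((2 : ℕ) : ℝ) + σ := by push_cast; linarith [hσ.1]
  have key1 := mul_volume_le_interL (D := 7 * R) hσ' (hF.inter measurableSet_ball)
    measurableSet_ball hneg (fun x hx => hsep _ x hx.2)
    (fun x hx y hy => norm_sub_le_of_mem_ball hR0 (by ring) hx.2 hy)
  have key2 := mul_volume_le_interL (D := 7 * R) hσ' (hF.compl.inter measurableSet_ball)
    measurableSet_ball hpos (fun x hx => hsep _ x hx.2)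
    (fun x hx y hy => norm_sub_le_of_mem_ball hR0 (by ring) hx.2 hy)
  refine le_trans ?_ (add_le_add key1 key2)
  rw [EuclideanSpace.volume_ball_fin_two, EuclideanSpace.volume_ball_fin_two, ← mul_add,
    inter_comm F, inter_comm Fᶜ, ← sdiff_eq, measure_inter_add_sdiff _ hF,
    EuclideanSpace.volume_ball_fin_two, ← ENNReal.ofReal_pow hR0,
    ← ENNReal.ofReal_mul (by positivity), ← ENNReal.ofReal_mul (by positivity),
    ← ENNReal.ofReal_mul (by positivity)]
  exact ENNReal.ofReal_le_ofReal (two_le_rpow_mul hσ hR)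

lemma HasWeakGradOn.integrable_apply_mul {n : ℕ} {u : Pt n → ℝ} {G : Pt n → Pt n}
    {U : Set (Pt n)} (h : HasWeakGradOn n u G U) (i : Fin n) {φ : Pt n → ℝ} (hφ : Continuous φ)
    (hc : HasCompactSupport φ) (hU : tsupport φ ⊆ U) : Integrable (fun x => G x i * φ x) := by
  have h1 : IntegrableOn (fun x => G x i) (tsupport φ) :=
    (EuclideanSpace.proj (𝕜 := ℝ) i).integrable_comp (h.1.integrableOn_compact_subset hU hc)
  refine (integrableOn_iff_integrable_of_support_subset ?_).1
    (h1.mul_continuousOn hφ.continuousOn hc)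
  exact (Function.support_mul_subset_right _ _).trans (subset_tsupport φ)

lemma HasWeakGradOn.ae_eq_of_eqOn {n : ℕ} {u w : Pt n → ℝ} {G H : Pt n → Pt n}
    {U : Set (Pt n)} (hU : IsOpen U) (hu : HasWeakGradOn n u G U) (hw : HasWeakGradOn n w H U)
    (huw : ∀ x ∈ U, u x = w x) : ∀ᵐ x ∂(volume : Measure (Pt n)), x ∈ U → G x = H x := by
  have key : ∀ i, ∀ᵐ x ∂(volume : Measure (Pt n)), x ∈ U → G x i - H x i = 0 := by
    intro i
    refine hU.ae_eq_zero_of_integral_contDiff_smul_eq_zero ?_ ?_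
    · intro x hx
      obtain ⟨s, hs, hGs⟩ := (hu.1.sub hw.1) x hx
      exact ⟨s, hs, (EuclideanSpace.proj (𝕜 := ℝ) i).integrable_comp hGs⟩
    · intro φ hφ hc hsub
      have h1 := hu.2 i φ hφ hc hsub
      have h2 := hw.2 i φ hφ hc hsub
      have h3 : ∀ x, u x * fderiv ℝ φ x (EuclideanSpace.single i 1) =
          w x * fderiv ℝ φ x (EuclideanSpace.single i 1) := by
        intro x
        by_cases hx : x ∈ tsupport φ
        · rw [huw x (hsub hx)]
        · have : fderiv ℝ φ x = 0 := by
            by_contra h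
            exact hx (support_fderiv_subset ℝ h)
          simp [this]
      simp_rw [h3] at h1
      have h4 : ∫ x, (G x i * φ x - H x i * φ x) = 0 := by
        rw [integral_sub (hu.integrable_apply_mul i hφ.continuous hc hsub)
          (hw.integrable_apply_mul i hφ.continuous hc hsub)]
        linarith
      rw [← h4]
      congr 1 with x
      rw [smul_eq_mul]; ring
  filter_upwards [ae_all_iff.2 key] with x hx hxU
  ext i
  linarith [hx i hxU]

lemma HasWeakGradOn.mono {n : ℕ} {u : Pt n → ℝ} {G : Pt n → Pt n} {U V : Set (Pt n)}
    (h : HasWeakGradOn n u G U) (hVU : V ⊆ U) : HasWeakGradOn n u G V :=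
  ⟨h.1.mono_set hVU, fun i φ hφ hc hs => h.2 i φ hφ hc (hs.trans hVU)⟩

lemma HasWeakGradOn.sub {n : ℕ} {u w : Pt n → ℝ} {G H : Pt n → Pt n} {U : Set (Pt n)}
    (hu : HasWeakGradOn n u G U) (hw : HasWeakGradOn n w H U)
    (hui : LocallyIntegrable u volume) (hwi : LocallyIntegrable w volume) :
    HasWeakGradOn n (fun x => u x - w x) (fun x => G x - H x) U := by
  refine ⟨hu.1.sub hw.1, fun i φ hφ hc hs => ?_⟩
  have hcont : Continuous fun x => fderiv ℝ φ x (EuclideanSpace.single i 1) :=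
    (hφ.continuous_fderiv (by simp)).clm_apply continuous_const
  have hcs : HasCompactSupport fun x => fderiv ℝ φ x (EuclideanSpace.single i 1) :=
    hc.fderiv_apply ℝ _
  have h1 := hui.integrable_smul_right_of_hasCompactSupport hcont hcs
  have h2 := hwi.integrable_smul_right_of_hasCompactSupport hcont hcs
  simp only [smul_eq_mul] at h1 h2
  simp only [sub_mul, PiLp.sub_apply]
  rw [integral_sub h1 h2, integral_sub (hu.integrable_apply_mul i hφ.continuous hc hs)
    (hw.integrable_apply_mul i hφ.continuous hc hs), hu.2 i φ hφ hc hs, hw.2 i φ hφ hc hs]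
  ring

lemma hasWeakGradOn_zero (n : ℕ) (U : Set (Pt n)) : HasWeakGradOn n 0 0 U :=
  ⟨locallyIntegrable_zero.locallyIntegrableOn U, by simp⟩

lemma continuous_tildeU : Continuous tildeU := by
  unfold tildeU
  fun_prop

lemma continuous_tildeG : Continuous tildeG := by
  refine (PiLp.continuous_toLp 2 _).comp (continuous_pi fun i => ?_)
  fin_cases i <;> simp <;> fun_prop

lemma hasFDerivAt_tildeU (x : Pt 2) : HasFDerivAt tildeU
    (x 0 • (EuclideanSpace.proj 1 : Pt 2 →L[ℝ] ℝ) +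
      x 1 • (EuclideanSpace.proj 0 : Pt 2 →L[ℝ] ℝ)) x :=
  (EuclideanSpace.proj (𝕜 := ℝ) (0 : Fin 2)).hasFDerivAt.mul
    (EuclideanSpace.proj (𝕜 := ℝ) (1 : Fin 2)).hasFDerivAt

lemma fderiv_tildeU_apply_single (x : Pt 2) (i : Fin 2) :
    fderiv ℝ tildeU x (EuclideanSpace.single i 1) = tildeG x i := by
  rw [(hasFDerivAt_tildeU x).fderiv]
  fin_cases i <;> simp [tildeG]

lemma hasWeakGradOn_tildeU (U : Set (Pt 2)) : HasWeakGradOn 2 tildeU tildeG U := by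
  refine ⟨continuous_tildeG.locallyIntegrable.locallyIntegrableOn U, fun i φ hφ hc _ => ?_⟩
  have hcont : Continuous fun x => fderiv ℝ φ x (EuclideanSpace.single i 1) :=
    (hφ.continuous_fderiv (by simp)).clm_apply continuous_const
  have hG : Continuous fun x => tildeG x i :=
    (EuclideanSpace.proj (𝕜 := ℝ) i).continuous.comp continuous_tildeG
  have hmain := integral_mul_fderiv_eq_neg_fderiv_mul_of_integrable (μ := volume) (f := tildeU)
    (g := φ) (v := EuclideanSpace.single i 1) ?_ ?_ ?_
    (fun x _ => (hasFDerivAt_tildeU x).differentiableAt)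
    (fun x _ => hφ.differentiable (by simp) x)
  · simpa only [fderiv_tildeU_apply_single] using hmain
  · simp only [fderiv_tildeU_apply_single]
    exact (hG.mul hφ.continuous).integrable_of_hasCompactSupport hc.mul_left
  · exact (continuous_tildeU.mul hcont).integrable_of_hasCompactSupport
      (hc.fderiv_apply ℝ _).mul_left
  · exact (continuous_tildeU.mul hφ.continuous).integrable_of_hasCompactSupport hc.mul_left

/-- A weak gradient of a function vanishing off a ball vanishes a.e. off that ball. -/
lemma HasWeakGradOn.ae_eq_zero_off_ball {R : ℝ} {w : Pt 2 → ℝ} {H : Pt 2 → Pt 2}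
    (h : HasWeakGradOn 2 ((ball (0 : Pt 2) R).indicator w) H univ) :
    ∀ᵐ x ∂(volume : Measure (Pt 2)), x ∉ ball (0 : Pt 2) R → H x = 0 := by
  have h1 := (h.mono (subset_univ (closedBall (0 : Pt 2) R)ᶜ)).ae_eq_of_eqOn
    isClosed_closedBall.isOpen_compl (hasWeakGradOn_zero 2 _) fun x hx =>
      indicator_of_notMem (fun hb => hx (ball_subset_closedBall hb)) _
  filter_upwards [h1, measure_eq_zero_iff_ae_notMem.1
    (Measure.addHaar_sphere volume (0 : Pt 2) R)] with x hx hs hb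
  refine hx fun hc => ?_
  rw [← ball_union_sphere] at hc
  exact hc.elim hb hs

/-- Weak gradients of functions supported in a ball are orthogonal to a field `a eᵢ` with `a` a
linear form that is constant in the direction `eᵢ`. -/
lemma HasWeakGradOn.setIntegral_apply_mul_eq_zero {R : ℝ} (hR : 0 < R) {w : Pt 2 → ℝ}
    {H : Pt 2 → Pt 2} (h : HasWeakGradOn 2 ((ball (0 : Pt 2) R).indicator w) H univ)
    (i : Fin 2) (a : Pt 2 →L[ℝ] ℝ) (ha : a (EuclideanSpace.single i 1) = 0) :
    ∫ x in ball (0 : Pt 2) R, H x i * a x = 0 := by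
  let χ : ContDiffBump (0 : Pt 2) := ⟨R, 2 * R, hR, by linarith⟩
  have hχ : ∀ x ∈ ball (0 : Pt 2) R, χ x = 1 := fun x hx =>
    χ.one_of_mem_closedBall (ball_subset_closedBall hx)
  have hmain := h.2 i (fun x => χ x * a x) (χ.contDiff.mul a.contDiff)
    χ.hasCompactSupport.mul_right (subset_univ _)
  have hl : ∀ x, (ball (0 : Pt 2) R).indicator w x *
      fderiv ℝ (fun x => χ x * a x) x (EuclideanSpace.single i 1) = 0 := by
    intro x
    by_cases hx : x ∈ ball (0 : Pt 2) R
    · have heq : (fun x => χ x * a x) =ᶠ[𝓝 x] a := by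
        filter_upwards [isOpen_ball.mem_nhds hx] with y hy
        rw [hχ y hy, one_mul]
      rw [heq.fderiv_eq, a.fderiv, ha, mul_zero]
    · rw [indicator_of_notMem hx, zero_mul]
  simp only [hl, integral_zero] at hmain
  rw [← neg_eq_zero, hmain, ← integral_indicator measurableSet_ball]
  congr 1
  refine integral_congr_ae ?_
  filter_upwards [h.ae_eq_zero_off_ball] with x hx
  by_cases hb : x ∈ ball (0 : Pt 2) R
  · rw [indicator_of_mem hb, hχ x hb, one_mul]
  · rw [indicator_of_notMem hb, hx hb]
    simp

lemma setIntegral_norm_sq_tildeG_le {R : ℝ} (hR : 0 < R) {v : Pt 2 → ℝ} {Gv : Pt 2 → Pt 2}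
    (hv : LocallyIntegrable v volume) (hG : HasWeakGradOn 2 v Gv (ball (0 : Pt 2) R))
    (hGi : IntegrableOn (fun x => ‖Gv x‖ ^ 2) (ball (0 : Pt 2) R) volume)
    (hz : ZeroExtGradL2 2 (ball (0 : Pt 2) R) fun x => v x - tildeU x) :
    ∫ x in ball (0 : Pt 2) R, ‖tildeG x‖ ^ 2 ≤ ∫ x in ball (0 : Pt 2) R, ‖Gv x‖ ^ 2 := by
  obtain ⟨H, hH, -⟩ := hz
  have hGH := (hG.sub (hasWeakGradOn_tildeU _) hv
    continuous_tildeU.locallyIntegrable).ae_eq_of_eqOn isOpen_ball (hH.mono (subset_univ _))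
    fun x hx => by rw [indicator_of_mem hx]
  have hHa : ∀ (i : Fin 2) (a : Pt 2 →L[ℝ] ℝ),
      IntegrableOn (fun x => H x i * a x) (ball (0 : Pt 2) R) := by
    intro i a
    have h1 : IntegrableOn (fun x => H x i) (closedBall (0 : Pt 2) R) :=
      (EuclideanSpace.proj (𝕜 := ℝ) i).integrable_comp
        (hH.1.integrableOn_compact_subset (subset_univ _) (isCompact_closedBall 0 R))
    exact (h1.mul_continuousOn a.continuous.continuousOn
      (isCompact_closedBall 0 R)).mono_set ball_subset_closedBall
  have hT : IntegrableOn (fun x => ‖tildeG x‖ ^ 2) (ball (0 : Pt 2) R) :=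
    ((continuous_tildeG.norm.pow 2).continuousOn.integrableOn_compact
      (isCompact_closedBall 0 R)).mono_set ball_subset_closedBall
  let a : Fin 2 → Pt 2 →L[ℝ] ℝ := fun i => EuclideanSpace.proj i
  have h0 := hHa 0 (a 1)
  have h1 := hHa 1 (a 0)
  have hz0 := hH.setIntegral_apply_mul_eq_zero hR 0 (a 1) (by simp [a])
  have hz1 := hH.setIntegral_apply_mul_eq_zero hR 1 (a 0) (by simp [a])
  have h2 : IntegrableOn (fun x => 2 * (H x 0 * a 1 x + H x 1 * a 0 x)) (ball (0 : Pt 2) R) :=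
    (h0.add h1).const_mul 2
  have hsplit : ∫ x in ball (0 : Pt 2) R,
      (‖tildeG x‖ ^ 2 + 2 * (H x 0 * a 1 x + H x 1 * a 0 x)) =
      ∫ x in ball (0 : Pt 2) R, ‖tildeG x‖ ^ 2 := by
    rw [integral_add hT h2, integral_const_mul, integral_add h0 h1,
      hz0, hz1]
    simp
  rw [← hsplit]
  refine setIntegral_mono_on_ae (hT.add h2) hGi measurableSet_ball ?_
  filter_upwards [hGH] with x hx hxB
  have e : Gv x = tildeG x + H x := by rw [← hx hxB]; abel
  rw [e, EuclideanSpace.real_norm_sq_eq, EuclideanSpace.real_norm_sq_eq, Fin.sum_univ_two,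
    Fin.sum_univ_two]
  have e0 : tildeG x 0 = x 1 := by simp [tildeG]
  have e1 : tildeG x 1 = x 0 := by simp [tildeG]
  have ha : ∀ i, a i x = x i := fun _ => rfl
  simp only [PiLp.add_apply, e0, e1, ha]
  nlinarith [sq_nonneg (H x 0), sq_nonneg (H x 1)]

/-- minimality of `(ũ, Ẽ)` in large balls for the functional built
from `Φ̃` with `Φ̃ ≡ 1` on `[2,∞)` (Proposition 3.3). -/
theorem statement1 (σ : ℝ) (hσ : σ ∈ Set.Ioo (0 : ℝ) 1) :
    ∃ R_o : ℝ, 0 < R_o ∧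
      ∀ (Φ : ℝ → ℝ),
        MonotoneOn Φ (Set.Ici 0) →
        LowerSemicontinuousOn Φ (Set.Ici 0) →
        (∀ t : ℝ, 0 ≤ t → 0 ≤ Φ t) →
        (∀ t : ℝ, 2 ≤ t → Φ t = 1) →
        ∀ R : ℝ, R_o ≤ R →
          ∀ (v : Pt 2 → ℝ) (Gv : Pt 2 → Pt 2) (F : Set (Pt 2)),
            AdmissiblePair 2 σ (ball (0 : Pt 2) R) v Gv F →
            (∀ᵐ x ∂(volume : Measure (Pt 2)), x ∉ ball (0 : Pt 2) R → v x = tildeU x) →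
            ZeroExtGradL2 2 (ball (0 : Pt 2) R) (fun x => v x - tildeU x) →
            volume ((F \ ball (0 : Pt 2) R) ∆ (tildeE \ ball (0 : Pt 2) R)) = 0 →
            energyF 2 σ Φ (ball (0 : Pt 2) R) tildeG tildeE ≤
              energyF 2 σ Φ (ball (0 : Pt 2) R) Gv F := by
  refine ⟨100, by norm_num, fun Φ hmono _ _ hΦ R hR v Gv F hadm _ hz hFE => ?_⟩
  have hper : 2 ≤ (fracPer 2 σ F (ball (0 : Pt 2) R)).toReal :=
    (ENNReal.ofReal_le_iff_le_toReal hadm.perFin).1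
      (ofReal_two_le_fracPer hσ hR hadm.measE hFE)
  have hle : ∀ t : ℝ, 0 ≤ t → Φ t ≤ 1 := by
    intro t ht
    rw [← hΦ (max t 2) (le_max_right _ _)]
    exact hmono ht (ht.trans (le_max_left t 2)) (le_max_left _ _)
  unfold energyF
  rw [hΦ _ hper]
  exact add_le_add (setIntegral_norm_sq_tildeG_le (by linarith) hadm.locInt hadm.weakGrad
    hadm.dirichletFin hz) (hle _ ENNReal.toReal_nonneg)
end

section
/- Let n = 2 and let Φ : [0,∞) → [0,∞) be monotone nondecreasing with Φ(t) = t^γ for all t ∈ [0,1], where γ ∈ (0, 4/(2−σ)). Then there exists r_o > 0 such that for every r ∈ (0, r_o] the pair (ũ, Ẽ) is not a minimal pair in B_r; that is, there exists an admissible pair (v,F) in B_r with v = ũ a.e. outside B_r, with v − ũ (extended by 0 outside B_r) having a square-integrable weak gradient on all of ℝ², with F\B_r = Ẽ\B_r up to a set of measure zero, and with E_{B_r}(v,F) < E_{B_r}(ũ,Ẽ). -/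
open MeasureTheory Filter Set Metric Bornology
open scoped ENNReal Topology symmDiff

lemma measurable_ofReal_norm_sub_rpow (n : ℕ) (s : ℝ) :
    Measurable (fun z : Pt n × Pt n => ENNReal.ofReal (‖z.1 - z.2‖ ^ s)) := by
  fun_prop

lemma measurable_setLIntegral_kernel (n : ℕ) (s : ℝ) (B : Set (Pt n)) :
    Measurable (fun x : Pt n => ∫⁻ y in B, ENNReal.ofReal (‖x - y‖ ^ s)) :=
  (measurable_ofReal_norm_sub_rpow n s).lintegral_prod_right'

lemma interL_comm (n : ℕ) (σ : ℝ) (A B : Set (Pt n)) : interL n σ A B = interL n σ B A := by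
  unfold interL
  rw [lintegral_lintegral_swap (measurable_ofReal_norm_sub_rpow n _).aemeasurable]
  simp_rw [norm_sub_rev]

lemma interL_union_left {n : ℕ} {σ : ℝ} {A B : Set (Pt n)} (C : Set (Pt n))
    (hB : MeasurableSet B) (h : Disjoint A B) :
    interL n σ (A ∪ B) C = interL n σ A C + interL n σ B C :=
  lintegral_union hB h

lemma interL_union_right {n : ℕ} {σ : ℝ} {B C : Set (Pt n)} (A : Set (Pt n))
    (hC : MeasurableSet C) (h : Disjoint B C) :
    interL n σ A (B ∪ C) = interL n σ A B + interL n σ A C := by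
  rw [interL_comm, interL_union_left A hC h, interL_comm n σ B, interL_comm n σ C]

lemma interL_congr_left {n : ℕ} {σ : ℝ} {A B : Set (Pt n)} (C : Set (Pt n))
    (h : A =ᵐ[volume] B) : interL n σ A C = interL n σ B C :=
  setLIntegral_congr h

lemma interL_congr_right {n : ℕ} {σ : ℝ} {B C : Set (Pt n)} (A : Set (Pt n))
    (h : B =ᵐ[volume] C) : interL n σ A B = interL n σ A C := by
  rw [interL_comm, interL_congr_left A h, interL_comm]

lemma interL_pos {n : ℕ} {σ : ℝ} {A B : Set (Pt n)} (h : Disjoint A B) (hA : volume A ≠ 0)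
    (hB : volume B ≠ 0) : 0 < interL n σ A B := by
  unfold interL
  rw [setLIntegral_pos_iff (measurable_setLIntegral_kernel n _ B)]
  refine lt_of_lt_of_le (pos_iff_ne_zero.2 hA) (measure_mono fun x hx => ⟨?_, hx⟩)
  refine ne_of_gt ((setLIntegral_pos_iff (by fun_prop)).2 ?_)
  refine lt_of_lt_of_le (pos_iff_ne_zero.2 hB) (measure_mono fun y hy => ⟨?_, hy⟩)
  have hxy : x - y ≠ 0 := sub_ne_zero.2 (h.ne_of_mem hx hy)
  exact (ENNReal.ofReal_pos.2 (by positivity)).ne'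

lemma interL_preimage {n : ℕ} {σ k : ℝ} {c : ℝ≥0∞} {T : Pt n → Pt n} (hT : Measurable T)
    (hmap : (volume : Measure (Pt n)).map T = c • volume) (hk : 0 ≤ k)
    (hdist : ∀ x y, ‖T x - T y‖ = k * ‖x - y‖) {A B : Set (Pt n)}
    (hA : MeasurableSet A) (hB : MeasurableSet B) :
    ENNReal.ofReal (k ^ (-((n : ℝ) + σ))) * interL n σ (T ⁻¹' A) (T ⁻¹' B) =
      c * (c * interL n σ A B) := by
  have key : ∀ x, ENNReal.ofReal (k ^ (-((n : ℝ) + σ))) *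
      ∫⁻ y in T ⁻¹' B, ENNReal.ofReal (‖x - y‖ ^ (-((n : ℝ) + σ))) =
      c * ∫⁻ y in B, ENNReal.ofReal (‖T x - y‖ ^ (-((n : ℝ) + σ))) := by
    intro x
    rw [← smul_eq_mul c, ← lintegral_smul_measure, ← Measure.restrict_smul, ← hmap,
      setLIntegral_map hB (by fun_prop) hT, ← lintegral_const_mul _ (by fun_prop)]
    refine lintegral_congr fun y => ?_
    rw [hdist, Real.mul_rpow hk (norm_nonneg _), ENNReal.ofReal_mul (by positivity)]
  unfold interL
  rw [← lintegral_const_mul _ (measurable_setLIntegral_kernel n _ _),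
    ← lintegral_const_mul _ (measurable_setLIntegral_kernel n _ _)]
  simp_rw [key]
  rw [← smul_eq_mul c, ← lintegral_smul_measure, ← Measure.restrict_smul, ← hmap,
    setLIntegral_map hA ((measurable_setLIntegral_kernel n _ _).const_mul _) hT]

lemma interL_preimage_isometry {n : ℕ} {σ : ℝ} {T : Pt n → Pt n} (hT : MeasurePreserving T)
    (hdist : Isometry T) {A B : Set (Pt n)} (hA : MeasurableSet A) (hB : MeasurableSet B) :
    interL n σ (T ⁻¹' A) (T ⁻¹' B) = interL n σ A B := by
  have := interL_preimage (σ := σ) (k := 1) (c := 1) hT.measurable (by rw [hT.map_eq, one_smul])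
    zero_le_one (fun x y => by rw [← dist_eq_norm, hdist.dist_eq, dist_eq_norm, one_mul]) hA hB
  simpa using this

/-- The set obtained from `A` by dilation with factor `r`. -/

def dilate (n : ℕ) (r : ℝ) (A : Set (Pt n)) : Set (Pt n) := (fun p => r⁻¹ • p) ⁻¹' A

lemma interL_dilate {n : ℕ} {σ r : ℝ} (hr : 0 < r) {A B : Set (Pt n)} (hA : MeasurableSet A)
    (hB : MeasurableSet B) :
    interL n σ (dilate n r A) (dilate n r B) =
      ENNReal.ofReal (r ^ ((n : ℝ) - σ)) * interL n σ A B := by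
  have hmap : (volume : Measure (Pt n)).map (fun p => r⁻¹ • p) =
      ENNReal.ofReal (r ^ (n : ℝ)) • volume := by
    rw [Measure.map_addHaar_smul _ (inv_ne_zero hr.ne'), finrank_euclideanSpace_fin, inv_pow,
      inv_inv, abs_of_pos (by positivity), Real.rpow_natCast]
  have h := interL_preimage (σ := σ) (by fun_prop) hmap (inv_nonneg.2 hr.le)
    (fun x y => by rw [← smul_sub, norm_smul, Real.norm_of_nonneg (inv_nonneg.2 hr.le)]) hA hB
  have hpos : 0 < r ^ ((n : ℝ) + σ) := by positivity
  rw [Real.rpow_neg (by positivity), Real.inv_rpow hr.le, inv_inv] at h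
  rw [← ENNReal.mul_right_inj (ENNReal.ofReal_pos.2 hpos).ne' ENNReal.ofReal_ne_top]
  refine h.trans ?_
  rw [← mul_assoc, ← mul_assoc, ← ENNReal.ofReal_mul (by positivity),
    ← ENNReal.ofReal_mul (by positivity), ← Real.rpow_add hr, ← Real.rpow_add hr]
  congr 3
  ring

lemma fracPer_dilate {n : ℕ} {σ r : ℝ} (hr : 0 < r) {E D : Set (Pt n)} (hE : MeasurableSet E)
    (hD : MeasurableSet D) :
    fracPer n σ (dilate n r E) (dilate n r D) =
      ENNReal.ofReal (r ^ ((n : ℝ) - σ)) * fracPer n σ E D := by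
  unfold fracPer
  rw [mul_add, ← interL_dilate hr (hE.inter hD) hE.compl,
    ← interL_dilate hr (hE.compl.inter hD) (hE.inter hD.compl)]
  rfl

lemma dilate_ball {n : ℕ} {r : ℝ} (hr : 0 < r) : dilate n r (ball 0 1) = ball 0 r := by
  ext p
  simp only [dilate, mem_preimage, mem_ball_zero_iff, norm_smul, norm_inv,
    Real.norm_of_nonneg hr.le]
  rw [inv_mul_lt_iff₀ hr, mul_one]

lemma dilate_tildeE {r : ℝ} (hr : 0 < r) : dilate 2 r tildeE = tildeE := by
  ext p
  have : r⁻¹ * p 0 * (r⁻¹ * p 1) = (r⁻¹) ^ 2 * (p 0 * p 1) := by ring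
  simp only [dilate, tildeE, mem_preimage, mem_ofPred_eq, PiLp.smul_apply, smul_eq_mul, this]
  exact mul_pos_iff_of_pos_left (by positivity)

lemma measurableSet_tildeE : MeasurableSet tildeE :=
  measurableSet_lt measurable_const (by fun_prop)

/-- The reflection of `ℝⁿ` across the hyperplane `p i = c / 2`. -/

def reflectCoord (n : ℕ) (i : Fin n) (c : ℝ) (p : Pt n) : Pt n :=
  WithLp.toLp 2 fun j => if j = i then c - p j else p j

@[simp] lemma reflectCoord_apply {n : ℕ} (i j : Fin n) (c : ℝ) (p : Pt n) :
    reflectCoord n i c p j = if j = i then c - p j else p j := rfl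

lemma isometry_reflectCoord {n : ℕ} (i : Fin n) (c : ℝ) : Isometry (reflectCoord n i c) := by
  refine Isometry.of_dist_eq fun x y => ?_
  simp only [EuclideanSpace.dist_eq, reflectCoord_apply]
  congr 1
  refine Finset.sum_congr rfl fun j _ => ?_
  split_ifs
  · rw [dist_sub_left]
  · rfl

lemma measurePreserving_reflectCoord {n : ℕ} (i : Fin n) (c : ℝ) :
    MeasurePreserving (reflectCoord n i c) := by
  have h := volume_preserving_pi (f := fun (j : Fin n) (t : ℝ) => if j = i then c - t else t)
    (fun j => by
      by_cases hj : j = i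
      · simpa [hj] using Measure.measurePreserving_sub_left (volume : Measure ℝ) c
      · simpa [hj, Function.id_def] using MeasurePreserving.id (volume : Measure ℝ))
  exact (PiLp.volume_preserving_toLp (Fin n)).comp (h.comp (PiLp.volume_preserving_ofLp (Fin n)))

lemma ae_coord_ne {n : ℕ} (i : Fin n) (c : ℝ) : ∀ᵐ p ∂(volume : Measure (Pt n)), p i ≠ c := by
  have h : ∀ᵐ q ∂(volume : Measure (Fin n → ℝ)), q i ≠ c := by
    rw [ae_iff]
    simpa [volume_pi] using Measure.pi_hyperplane (fun _ : Fin n => (volume : Measure ℝ)) i c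
  exact (PiLp.volume_preserving_ofLp (Fin n)).quasiMeasurePreserving.ae h

/-- The square of side `1/4` at the origin in the open second quadrant. -/

def sqNW : Set (Pt 2) := {p | (-(1 / 4) < p 0 ∧ p 0 < 0) ∧ 0 < p 1 ∧ p 1 < 1 / 4}

/-- The square of side `1/4` at the origin in the open fourth quadrant. -/

def sqSE : Set (Pt 2) := {p | (0 < p 0 ∧ p 0 < 1 / 4) ∧ -(1 / 4) < p 1 ∧ p 1 < 0}

/-- The cross `tildeE` with the two squares at the origin filled in. -/

def filledE : Set (Pt 2) := tildeE ∪ (sqNW ∪ sqSE)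

lemma measurableSet_sqNW : MeasurableSet sqNW := by
  unfold sqNW; measurability

lemma measurableSet_sqSE : MeasurableSet sqSE := by
  unfold sqSE; measurability

lemma measurableSet_filledE : MeasurableSet filledE :=
  measurableSet_tildeE.union (measurableSet_sqNW.union measurableSet_sqSE)

lemma disjoint_sqNW_sqSE : Disjoint sqNW sqSE :=
  Set.disjoint_left.2 fun _ hp hq => lt_asymm hp.1.2 hq.1.1

lemma disjoint_tildeE_sqNW : Disjoint tildeE sqNW :=
  Set.disjoint_left.2 fun _ hp hq => lt_asymm hp (mul_neg_of_neg_of_pos hq.1.2 hq.2.1)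

lemma disjoint_tildeE_sqSE : Disjoint tildeE sqSE :=
  Set.disjoint_left.2 fun _ hp hq => lt_asymm hp (mul_neg_of_pos_of_neg hq.1.1 hq.2.2)

lemma not_mul_pos_and_not_mem_square_iff {a b : ℝ} (h1 : a ≠ -(1 / 4)) (h2 : a ≠ 0) (h3 : b ≠ 0)
    (h4 : b ≠ 1 / 4) :
    (¬ 0 < a * b) ∧ ¬ ((-(1 / 4) < a ∧ a < 0) ∧ 0 < b ∧ b < 1 / 4) ↔
      ((0 < -(1 / 4) - a ∧ 0 < b) ∨ ((-(1 / 4) < a ∧ a < 0) ∧ 1 / 4 - b < 0)) ∨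
        (-(1 / 4) - a < -(1 / 4) ∧ b < 0) := by
  rw [mul_pos_iff]
  grind

lemma interL_sqNW_tildeE (σ : ℝ) :
    interL 2 σ sqNW tildeE = interL 2 σ sqNW (tildeEᶜ \ sqNW) := by
  set T₁ := reflectCoord 2 0 (-(1 / 4))
  set T₂ := reflectCoord 2 1 (1 / 4)
  set Q : Set (Pt 2) := {p | 0 < p 0 ∧ 0 < p 1}
  set M : Set (Pt 2) := {p | (-(1 / 4) < p 0 ∧ p 0 < 0) ∧ p 1 < 0}
  set L : Set (Pt 2) := {p | p 0 < -(1 / 4) ∧ p 1 < 0}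
  have hT₁ : MeasurePreserving T₁ := measurePreserving_reflectCoord 0 _
  have hT₂ : MeasurePreserving T₂ := measurePreserving_reflectCoord 1 _
  have mQ : MeasurableSet Q := by measurability
  have mM : MeasurableSet M := by measurability
  have mL : MeasurableSet L := by measurability
  have hA₁ : T₁ ⁻¹' sqNW = sqNW := by
    ext p
    simp [T₁, sqNW]
    grind
  have hA₂ : T₂ ⁻¹' sqNW = sqNW := by
    ext p
    simp [T₂, sqNW]
    grind
  have hE : tildeE =ᵐ[volume] ((Q ∪ M) ∪ L : Set (Pt 2)) := by
    filter_upwards [ae_coord_ne (0 : Fin 2) (-(1 / 4))] with p hp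
    apply propext
    change 0 < p 0 * p 1 ↔
      ((0 < p 0 ∧ 0 < p 1) ∨ ((-(1 / 4) < p 0 ∧ p 0 < 0) ∧ p 1 < 0)) ∨ (p 0 < -(1 / 4) ∧ p 1 < 0)
    rw [mul_pos_iff]
    grind
  have hEc : (tildeEᶜ \ sqNW : Set (Pt 2)) =ᵐ[volume]
      ((T₁ ⁻¹' Q ∪ T₂ ⁻¹' M) ∪ T₁ ⁻¹' L : Set (Pt 2)) := by
    filter_upwards [ae_coord_ne (0 : Fin 2) (-(1 / 4)), ae_coord_ne (0 : Fin 2) 0,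
      ae_coord_ne (1 : Fin 2) 0, ae_coord_ne (1 : Fin 2) (1 / 4)] with p h1 h2 h3 h4
    apply propext
    change (¬ 0 < p 0 * p 1) ∧ ¬ ((-(1 / 4) < p 0 ∧ p 0 < 0) ∧ 0 < p 1 ∧ p 1 < 1 / 4) ↔
      ((0 < -(1 / 4) - p 0 ∧ 0 < p 1) ∨ ((-(1 / 4) < p 0 ∧ p 0 < 0) ∧ 1 / 4 - p 1 < 0)) ∨
        (-(1 / 4) - p 0 < -(1 / 4) ∧ p 1 < 0)
    exact not_mul_pos_and_not_mem_square_iff h1 h2 h3 h4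
  have dQM : Disjoint Q M := Set.disjoint_left.2 fun p hp hq => lt_asymm hp.1 hq.1.2
  have dL : Disjoint (Q ∪ M) L := Set.disjoint_left.2 fun p hp hq => by
    obtain hp | hp := hp
    · exact lt_asymm hp.2 hq.2
    · exact lt_asymm hp.1.1 hq.1
  have dQM' : Disjoint (T₁ ⁻¹' Q) (T₂ ⁻¹' M) := Set.disjoint_left.2 fun p hp hq => by
    have h1 : 0 < -(1 / 4) - p 0 := hp.1
    have h2 : -(1 / 4) < p 0 := hq.1.1
    linarith
  have dL' : Disjoint (T₁ ⁻¹' Q ∪ T₂ ⁻¹' M) (T₁ ⁻¹' L) := Set.disjoint_left.2 fun p hp hq => by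
    have h3 : -(1 / 4) - p 0 < -(1 / 4) := hq.1
    obtain hp | hp := hp
    · have h1 : 0 < -(1 / 4) - p 0 := hp.1
      linarith
    · have h1 : p 0 < 0 := hp.1.2
      linarith
  rw [interL_congr_right _ hE, interL_congr_right _ hEc, interL_union_right _ mL dL,
    interL_union_right _ mM dQM, interL_union_right _ (hT₁.measurable mL) dL',
    interL_union_right _ (hT₂.measurable mM) dQM']
  have e (X : Set (Pt 2)) (hX : MeasurableSet X) :
      interL 2 σ sqNW (T₁ ⁻¹' X) = interL 2 σ sqNW X := by
    conv_lhs => rw [← hA₁]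
    exact interL_preimage_isometry hT₁ (isometry_reflectCoord _ _) measurableSet_sqNW hX
  have e' : interL 2 σ sqNW (T₂ ⁻¹' M) = interL 2 σ sqNW M := by
    conv_lhs => rw [← hA₂]
    exact interL_preimage_isometry hT₂ (isometry_reflectCoord _ _) measurableSet_sqNW mM
  rw [e Q mQ, e L mL, e']

lemma interL_sqNW_tildeE_eq_add (σ : ℝ) :
    interL 2 σ sqNW tildeE = interL 2 σ sqNW filledEᶜ + interL 2 σ sqNW sqSE := by
  have : (tildeEᶜ \ sqNW : Set (Pt 2)) = filledEᶜ ∪ sqSE := by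
    ext p
    have h1 : p ∈ tildeE → p ∉ sqSE := fun h => Set.disjoint_left.1 disjoint_tildeE_sqSE h
    have h2 : p ∈ sqNW → p ∉ sqSE := fun h => Set.disjoint_left.1 disjoint_sqNW_sqSE h
    simp only [filledE, Set.mem_sdiff, mem_compl_iff, mem_union]
    tauto
  rw [interL_sqNW_tildeE, this, interL_union_right _ measurableSet_sqSE]
  exact Set.disjoint_left.2 fun p hp hq => hp (Or.inr (Or.inr hq))

lemma interL_sqSE_tildeE_eq_add (σ : ℝ) :
    interL 2 σ sqSE tildeE = interL 2 σ sqSE filledEᶜ + interL 2 σ sqNW sqSE := by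
  have hm : MeasurePreserving (fun p : Pt 2 => -p) := Measure.measurePreserving_neg _
  have hi : Isometry (fun p : Pt 2 => -p) := Isometry.of_dist_eq fun x y => dist_neg_neg x y
  have hNW : (fun p : Pt 2 => -p) ⁻¹' sqNW = sqSE := by
    ext p
    simp [sqNW, sqSE]
    grind
  have hSE : (fun p : Pt 2 => -p) ⁻¹' sqSE = sqNW := by
    ext p
    simp [sqNW, sqSE]
    grind
  have hE : (fun p : Pt 2 => -p) ⁻¹' tildeE = tildeE := by
    ext p
    simp [tildeE]
  have hF : (fun p : Pt 2 => -p) ⁻¹' filledE = filledE := by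
    rw [filledE, preimage_union, preimage_union, hE, hNW, hSE, union_comm sqSE]
  have h := interL_sqNW_tildeE_eq_add σ
  rw [← interL_preimage_isometry hm hi measurableSet_sqNW measurableSet_tildeE,
    ← interL_preimage_isometry hm hi measurableSet_sqNW measurableSet_filledE.compl,
    preimage_compl, hNW, hE, hF] at h
  exact h

lemma sqNW_union_sqSE_subset_ball : sqNW ∪ sqSE ⊆ ball (0 : Pt 2) (1 / 2) := by
  have key : ∀ p : Pt 2, p 0 ^ 2 < 1 / 16 → p 1 ^ 2 < 1 / 16 → p ∈ ball (0 : Pt 2) (1 / 2) := by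
    intro p h0 h1
    rw [mem_ball_zero_iff, EuclideanSpace.norm_eq, Real.sqrt_lt' (by norm_num)]
    simp only [Fin.sum_univ_two, Real.norm_eq_abs, sq_abs]
    linarith
  rintro p (⟨⟨h1, h2⟩, h3, h4⟩ | ⟨⟨h1, h2⟩, h3, h4⟩) <;> exact key p (by nlinarith) (by nlinarith)

lemma volume_ne_zero_of_isOpen_of_mem {A : Set (Pt 2)} (hA : IsOpen A) {p : Pt 2} (hp : p ∈ A) :
    volume A ≠ 0 :=
  (hA.measure_pos _ ⟨p, hp⟩).ne'

lemma interL_sqNW_sqSE_pos (σ : ℝ) : 0 < interL 2 σ sqNW sqSE := by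
  refine interL_pos disjoint_sqNW_sqSE ?_ ?_
  · refine volume_ne_zero_of_isOpen_of_mem (p := !₂[-(1 / 8), 1 / 8]) ?_ ?_
    · have h0 : Continuous fun p : Pt 2 => p 0 := by fun_prop
      have h1 : Continuous fun p : Pt 2 => p 1 := by fun_prop
      exact ((isOpen_lt continuous_const h0).inter (isOpen_lt h0 continuous_const)).inter
        ((isOpen_lt continuous_const h1).inter (isOpen_lt h1 continuous_const))
    · simp [sqNW]; norm_num
  · refine volume_ne_zero_of_isOpen_of_mem (p := !₂[1 / 8, -(1 / 8)]) ?_ ?_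
    · have h0 : Continuous fun p : Pt 2 => p 0 := by fun_prop
      have h1 : Continuous fun p : Pt 2 => p 1 := by fun_prop
      exact ((isOpen_lt continuous_const h0).inter (isOpen_lt h0 continuous_const)).inter
        ((isOpen_lt continuous_const h1).inter (isOpen_lt h1 continuous_const))
    · simp [sqSE]; norm_num

/-- Filling in a set `N ⊆ Eᶜ` that interacts more with `E` than with the rest of `Eᶜ` lowers the
fractional perimeter. -/

lemma fracPer_union_lt {n : ℕ} {σ : ℝ} {E N D : Set (Pt n)} (hE : MeasurableSet E)
    (hN : MeasurableSet N) (hD : MeasurableSet D) (hND : N ⊆ D) (hEN : Disjoint E N)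
    (hfin : fracPer n σ E D ≠ ∞) (hlt : interL n σ N (E ∪ N)ᶜ < interL n σ N E) :
    fracPer n σ (E ∪ N) D < fracPer n σ E D := by
  have hFD : (E ∪ N) ∩ D = (E ∩ D) ∪ N := by
    rw [union_inter_distrib_right, inter_eq_left.2 hND]
  have hFDc : (E ∪ N) ∩ Dᶜ = E ∩ Dᶜ := by
    ext p
    have : p ∈ N → p ∈ D := fun h => hND h
    simp only [mem_inter_iff, mem_union, mem_compl_iff]
    tauto
  have hEc : Eᶜ = (E ∪ N)ᶜ ∪ N := by
    ext p
    have : p ∈ E → p ∉ N := fun h => Set.disjoint_left.1 hEN h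
    simp only [mem_union, mem_compl_iff]
    tauto
  have hEcD : Eᶜ ∩ D = ((E ∪ N)ᶜ ∩ D) ∪ N := by
    rw [hEc, union_inter_distrib_right, inter_eq_left.2 hND]
  have d1 : Disjoint (E ∪ N)ᶜ N := Set.disjoint_left.2 fun p hp hq => hp (Or.inr hq)
  have hNE : interL n σ N E = interL n σ (E ∩ D) N + interL n σ N (E ∩ Dᶜ) := by
    rw [interL_comm n σ (E ∩ D), ← interL_union_right _ (hE.inter hD.compl), inter_union_compl]
    exact Set.disjoint_left.2 fun p hp hq => hq.2 hp.2
  have hper : fracPer n σ E D = interL n σ (E ∩ D) (E ∪ N)ᶜ +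
      interL n σ ((E ∪ N)ᶜ ∩ D) (E ∩ Dᶜ) + interL n σ N E := by
    unfold fracPer
    rw [hNE, hEcD, interL_union_left _ hN (d1.mono_left inter_subset_left)]
    conv_lhs => rw [hEc, interL_union_right _ hN d1]
    ring
  have hper' : fracPer n σ (E ∪ N) D = interL n σ (E ∩ D) (E ∪ N)ᶜ +
      interL n σ ((E ∪ N)ᶜ ∩ D) (E ∩ Dᶜ) + interL n σ N (E ∪ N)ᶜ := by
    unfold fracPer
    rw [hFD, hFDc, interL_union_left _ hN (hEN.mono_left inter_subset_left)]
    ring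
  rw [hper] at hfin ⊢
  rw [hper']
  exact (ENNReal.add_lt_add_iff_left (ne_top_of_le_ne_top hfin le_self_add)).2 hlt

lemma fracPer_filledE_lt {σ : ℝ} (hfin : fracPer 2 σ tildeE (ball 0 1) ≠ ∞) :
    fracPer 2 σ filledE (ball 0 1) < fracPer 2 σ tildeE (ball 0 1) := by
  have hN : sqNW ∪ sqSE ⊆ ball (0 : Pt 2) 1 :=
    sqNW_union_sqSE_subset_ball.trans (ball_subset_ball (by norm_num))
  have hd : Disjoint tildeE (sqNW ∪ sqSE) :=
    Set.disjoint_union_right.2 ⟨disjoint_tildeE_sqNW, disjoint_tildeE_sqSE⟩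
  refine fracPer_union_lt measurableSet_tildeE (measurableSet_sqNW.union measurableSet_sqSE)
    measurableSet_ball hN hd hfin ?_
  change interL 2 σ (sqNW ∪ sqSE) filledEᶜ < _
  have hle : interL 2 σ (sqNW ∪ sqSE) tildeE ≤ fracPer 2 σ tildeE (ball 0 1) := by
    have hsub : sqNW ∪ sqSE ⊆ tildeEᶜ ∩ ball 0 1 :=
      fun p hp => ⟨fun h => Set.disjoint_left.1 hd h hp, hN hp⟩
    have hsplit : tildeE = (tildeE ∩ ball 0 1) ∪ (tildeE ∩ (ball 0 1)ᶜ) :=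
      (inter_union_compl _ _).symm
    have hdis : Disjoint (tildeE ∩ ball (0 : Pt 2) 1) (tildeE ∩ (ball 0 1)ᶜ) :=
      Set.disjoint_left.2 fun p hp hq => hq.2 hp.2
    conv_lhs => rw [hsplit]
    rw [interL_union_right _ (measurableSet_tildeE.inter measurableSet_ball.compl) hdis]
    unfold fracPer
    refine add_le_add ?_ (lintegral_mono_set hsub)
    rw [interL_comm 2 σ _ tildeEᶜ]
    exact lintegral_mono_set (hsub.trans inter_subset_left)
  have hne := ne_top_of_le_ne_top hfin hle
  have heq : interL 2 σ (sqNW ∪ sqSE) tildeE = interL 2 σ (sqNW ∪ sqSE) filledEᶜ +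
      (interL 2 σ sqNW sqSE + interL 2 σ sqNW sqSE) := by
    rw [interL_union_left _ measurableSet_sqSE disjoint_sqNW_sqSE,
      interL_union_left _ measurableSet_sqSE disjoint_sqNW_sqSE, interL_sqNW_tildeE_eq_add,
      interL_sqSE_tildeE_eq_add]
    ring
  rw [heq] at hne ⊢
  exact ENNReal.lt_add_right (ne_top_of_le_ne_top hne le_self_add)
    ((interL_sqNW_sqSE_pos σ).trans_le le_self_add).ne'

lemma setLIntegral_kernel_le {n : ℕ} {σ : ℝ} (hσ : 0 < σ) :
    ∃ C : ℝ≥0∞, C ≠ ∞ ∧ ∀ (x : Pt n) (d : ℝ), 0 < d → ∀ B : Set (Pt n), MeasurableSet B →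
      (∀ y ∈ B, d ≤ ‖x - y‖) →
      ∫⁻ y in B, ENNReal.ofReal (‖x - y‖ ^ (-((n : ℝ) + σ))) ≤ ENNReal.ofReal (d ^ (-σ)) * C := by
  have hs : 0 < (n : ℝ) + σ := by positivity
  set J : ℝ≥0∞ := ∫⁻ z : Pt n, ENNReal.ofReal ((1 + ‖z‖) ^ (-((n : ℝ) + σ))) with hJ
  have hJfin : J < ∞ := finite_integral_one_add_norm (by
    rw [finrank_euclideanSpace_fin]; linarith)
  refine ⟨ENNReal.ofReal (2 ^ ((n : ℝ) + σ)) * J,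
    ENNReal.mul_ne_top ENNReal.ofReal_ne_top hJfin.ne, fun x d hd B hB hdist => ?_⟩
  have hscale : ∫⁻ y : Pt n, ENNReal.ofReal ((1 + ‖d⁻¹ • (x - y)‖) ^ (-((n : ℝ) + σ))) =
      ENNReal.ofReal (d ^ (n : ℝ)) * J := by
    rw [lintegral_sub_left_eq_self
      (fun z : Pt n => ENNReal.ofReal ((1 + ‖d⁻¹ • z‖) ^ (-((n : ℝ) + σ)))) x, hJ,
      ← smul_eq_mul, ← lintegral_smul_measure]
    have hmap : (volume : Measure (Pt n)).map (fun p => d⁻¹ • p) =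
        ENNReal.ofReal (d ^ (n : ℝ)) • volume := by
      rw [Measure.map_addHaar_smul _ (inv_ne_zero hd.ne'), finrank_euclideanSpace_fin, inv_pow,
        inv_inv, abs_of_pos (by positivity), Real.rpow_natCast]
    rw [← hmap, lintegral_map (by fun_prop) (by fun_prop)]
  calc ∫⁻ y in B, ENNReal.ofReal (‖x - y‖ ^ (-((n : ℝ) + σ)))
      ≤ ∫⁻ y in B, ENNReal.ofReal ((d / 2) ^ (-((n : ℝ) + σ))) *
          ENNReal.ofReal ((1 + ‖d⁻¹ • (x - y)‖) ^ (-((n : ℝ) + σ))) := by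
        refine setLIntegral_mono' hB fun y hy => ?_
        rw [← ENNReal.ofReal_mul (by positivity), ← Real.mul_rpow (by positivity) (by positivity)]
        refine ENNReal.ofReal_le_ofReal (Real.rpow_le_rpow_of_nonpos (by positivity) ?_
          (neg_nonpos.2 hs.le))
        rw [norm_smul, norm_inv, Real.norm_of_nonneg hd.le]
        have := hdist y hy
        field_simp
        linarith
    _ ≤ ∫⁻ y, ENNReal.ofReal ((d / 2) ^ (-((n : ℝ) + σ))) *
          ENNReal.ofReal ((1 + ‖d⁻¹ • (x - y)‖) ^ (-((n : ℝ) + σ))) := setLIntegral_le_lintegral _ _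
    _ = ENNReal.ofReal (d ^ (-σ)) * (ENNReal.ofReal (2 ^ ((n : ℝ) + σ)) * J) := by
        rw [lintegral_const_mul _ (by fun_prop), hscale, ← mul_assoc, ← mul_assoc,
          ← ENNReal.ofReal_mul (by positivity), ← ENNReal.ofReal_mul (by positivity)]
        congr 2
        rw [Real.div_rpow hd.le (by norm_num), Real.rpow_neg (by norm_num : (0 : ℝ) ≤ 2),
          div_inv_eq_mul, mul_right_comm, ← Real.rpow_add hd]
        congr 2
        ring

lemma setLIntegral_prod_abs_rpow_lt_top {n : ℕ} {σ : ℝ} (hσ : σ < 1) :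
    ∫⁻ p in ball (0 : Pt n) 1, ENNReal.ofReal (∏ i, |p i| ^ (-σ)) < ∞ := by
  set g : ℝ → ℝ := (Icc (-1) 1).indicator fun t => |t| ^ (-σ)
  have hg : Integrable g := by
    rw [integrable_indicator_iff measurableSet_Icc]
    have h0 : IntegrableOn (fun t : ℝ => |t| ^ (-σ)) (Icc 0 1) := by
      have := (intervalIntegral.intervalIntegrable_rpow' (a := 0) (b := 1) (r := -σ) (by linarith))
      rw [intervalIntegrable_iff_integrableOn_Icc_of_le zero_le_one] at this
      exact this.congr_fun (fun t ht => by rw [abs_of_nonneg ht.1]) measurableSet_Icc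
    have h1 : IntegrableOn (fun t : ℝ => |t| ^ (-σ)) (Icc (-1) 0) := by
      have := h0.comp_neg
      simpa using this
    rw [← Icc_union_Icc_eq_Icc (by norm_num : (-1 : ℝ) ≤ 0) zero_le_one]
    exact h1.union h0
  have hprod : Integrable (fun q : Fin n → ℝ => ∏ i, g (q i)) :=
    Integrable.fintype_prod (fun _ => hg)
  have hprod' : Integrable (fun p : Pt n => ∏ i, g (p i)) :=
    (PiLp.volume_preserving_ofLp (Fin n)).integrable_comp_of_integrable hprod
  refine lt_of_le_of_lt ?_ hprod'.lintegral_lt_top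
  refine (setLIntegral_mono' measurableSet_ball fun p hp => ?_).trans (setLIntegral_le_lintegral _ _)
  refine (congrArg ENNReal.ofReal (Finset.prod_congr rfl fun i _ => ?_)).le
  have hi : |p i| ≤ 1 :=
    (PiLp.norm_apply_le p i).trans (mem_ball_zero_iff.1 hp).le
  have hgi : g (p i) = |p i| ^ (-σ) := indicator_of_mem (s := Icc (-1 : ℝ) 1) (abs_le.1 hi) _
  exact hgi.symm

lemma interL_lt_top_of_le_dist {σ : ℝ} (hσ : σ ∈ Set.Ioo (0 : ℝ) 1) {A B : Set (Pt 2)}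
    (hA : A ⊆ ball 0 1) (hAm : MeasurableSet A) (hB : MeasurableSet B)
    (hdist : ∀ x ∈ A, ∀ y ∈ B, min |x 0| |x 1| ≤ ‖x - y‖) : interL 2 σ A B < ∞ := by
  obtain ⟨C, hC, hle⟩ := setLIntegral_kernel_le (n := 2) hσ.1
  have hbound : interL 2 σ A B ≤ ∫⁻ x in A, ENNReal.ofReal (∏ i, |x i| ^ (-σ)) * C := by
    refine lintegral_mono_ae ((ae_restrict_iff' hAm).2 ?_)
    filter_upwards [ae_coord_ne (0 : Fin 2) 0, ae_coord_ne (1 : Fin 2) 0] with x h0 h1 hx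
    have h0' : 0 < |x 0| := abs_pos.2 h0
    have h1' : 0 < |x 1| := abs_pos.2 h1
    refine (hle x _ (lt_min h0' h1') B hB (hdist x hx)).trans ?_
    gcongr
    rw [Fin.prod_univ_two]
    have hone (i : Fin 2) (hi : 0 < |x i|) : 1 ≤ |x i| ^ (-σ) :=
      Real.one_le_rpow_of_pos_of_le_one_of_nonpos hi
        ((PiLp.norm_apply_le x i).trans (mem_ball_zero_iff.1 (hA hx)).le) (neg_nonpos.2 hσ.1.le)
    rcases min_choice |x 0| |x 1| with h | h <;> rw [h]
    · exact le_mul_of_one_le_right (by positivity) (hone 1 h1')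
    · exact le_mul_of_one_le_left (by positivity) (hone 0 h0')
  refine hbound.trans_lt ?_
  rw [lintegral_mul_const _ (by fun_prop)]
  exact ENNReal.mul_lt_top
    ((lintegral_mono_set hA).trans_lt (setLIntegral_prod_abs_rpow_lt_top hσ.2)) hC.lt_top

lemma min_abs_le_norm_sub {x y : Pt 2} (h : ¬ (0 < x 0 * x 1 ↔ 0 < y 0 * y 1)) :
    min |x 0| |x 1| ≤ ‖x - y‖ := by
  by_contra! hlt
  have hcoord (i : Fin 2) : |x i - y i| ≤ ‖x - y‖ := PiLp.norm_apply_le (x - y) i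
  have h0 := (hcoord 0).trans_lt (hlt.trans_le (min_le_left _ _))
  have h1 := (hcoord 1).trans_lt (hlt.trans_le (min_le_right _ _))
  have key : ∀ {a b : ℝ}, |a - b| < |a| → 0 < a * b := by
    intro a b hab
    have := sq_lt_sq.2 hab
    nlinarith [sq_nonneg b]
  have h2 := mul_pos (key h0) (key h1)
  rw [mul_mul_mul_comm] at h2
  exact h ⟨fun hx => (mul_pos_iff_of_pos_left hx).1 h2, fun hy => (mul_pos_iff_of_pos_right hy).1 h2⟩

lemma fracPer_tildeE_ne_top {σ : ℝ} (hσ : σ ∈ Set.Ioo (0 : ℝ) 1) :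
    fracPer 2 σ tildeE (ball 0 1) ≠ ∞ := by
  have mE := measurableSet_tildeE
  refine (ENNReal.add_lt_top.2 ⟨?_, ?_⟩).ne
  · exact interL_lt_top_of_le_dist hσ inter_subset_right (mE.inter measurableSet_ball) mE.compl
      fun x hx y hy => min_abs_le_norm_sub fun h => hy (h.1 hx.1)
  · exact interL_lt_top_of_le_dist hσ inter_subset_right (mE.compl.inter measurableSet_ball)
      (mE.inter measurableSet_ball.compl) fun x hx y hy => min_abs_le_norm_sub fun h =>
        hx.1 (h.2 hy.1)

lemma norm_gradient {n : ℕ} (u : Pt n → ℝ) (x : Pt n) : ‖gradient u x‖ = ‖fderiv ℝ u x‖ := by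
  rw [gradient, LinearIsometryEquiv.norm_map]

lemma gradient_apply {n : ℕ} (u : Pt n → ℝ) (x : Pt n) (i : Fin n) :
    gradient u x i = fderiv ℝ u x (EuclideanSpace.single i 1) := by
  rw [← toDual_gradient, InnerProductSpace.toDual_apply_apply, EuclideanSpace.inner_single_right]
  simp

lemma continuous_gradient {n : ℕ} {u : Pt n → ℝ} (hu : ContDiff ℝ 1 u) :
    Continuous (gradient u) :=
  (LinearIsometryEquiv.continuous _).comp (hu.continuous_fderiv one_ne_zero)

lemma hasWeakGradOn_gradient {n : ℕ} {u : Pt n → ℝ} (hu : ContDiff ℝ 1 u) (U : Set (Pt n)) :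
    HasWeakGradOn n u (gradient u) U := by
  refine ⟨(continuous_gradient hu).locallyIntegrable.locallyIntegrableOn U,
    fun i φ hφ hφc _ => ?_⟩
  have hφ1 : Continuous (fderiv ℝ φ) := hφ.continuous_fderiv (by simp)
  have hu1 : Continuous (fderiv ℝ u) := hu.continuous_fderiv one_ne_zero
  simp_rw [gradient_apply]
  refine integral_mul_fderiv_eq_neg_fderiv_mul_of_integrable ?_ ?_ ?_
    (fun x _ => hu.differentiable one_ne_zero x)
    (fun x _ => hφ.differentiable (by simp) x)
  · exact ((hu1.clm_apply continuous_const).mul hφ.continuous).integrable_of_hasCompactSupport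
      hφc.mul_left
  · exact (hu.continuous.mul (hφ1.clm_apply continuous_const)).integrable_of_hasCompactSupport
      (hφc.fderiv_apply ℝ _).mul_left
  · exact (hu.continuous.mul hφ.continuous).integrable_of_hasCompactSupport hφc.mul_left

lemma zeroExtGradL2_of_contDiff {n : ℕ} {Ω : Set (Pt n)} {w : Pt n → ℝ} (hw : ContDiff ℝ 1 w)
    (hc : HasCompactSupport w) (h0 : ∀ x ∉ Ω, w x = 0) : ZeroExtGradL2 n Ω w := by
  have hind : Ω.indicator w = w := indicator_eq_self.2 fun x hx => by
    by_contra hxΩ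
    exact hx (h0 x hxΩ)
  refine ⟨gradient w, hind.symm ▸ hasWeakGradOn_gradient hw _, ?_⟩
  have hcont : Continuous fun x => ‖fderiv ℝ w x‖ := (hw.continuous_fderiv one_ne_zero).norm
  have hsupp : HasCompactSupport fun x => ‖fderiv ℝ w x‖ := (hc.fderiv (𝕜 := ℝ)).norm
  simp_rw [norm_gradient, sq]
  exact (hcont.mul hcont).integrable_of_hasCompactSupport hsupp.mul_left

/-- A smooth cutoff supported in the ball of radius `3 / 4` and equal to `1` on the ball of
radius `1 / 2`. -/
noncomputable def cutoff : ContDiffBump (0 : Pt 2) where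
  rIn := 1 / 2
  rOut := 3 / 4
  rIn_pos := by norm_num
  rIn_lt_rOut := by norm_num

/-- The function `xy` multiplied by a cutoff vanishing near the ball of radius `r / 2` and equal
to `1` near the complement of the ball of radius `r`. -/
noncomputable def cutU (r : ℝ) (p : Pt 2) : ℝ := tildeU p * (1 - cutoff (r⁻¹ • p))

lemma contDiff_tildeU : ContDiff ℝ 1 tildeU := by
  unfold tildeU; fun_prop

lemma contDiff_cutoff_smul (r : ℝ) : ContDiff ℝ 1 fun p : Pt 2 => cutoff (r⁻¹ • p) :=
  cutoff.contDiff.comp (contDiff_const_smul _)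

lemma contDiff_cutU (r : ℝ) : ContDiff ℝ 1 (cutU r) :=
  contDiff_tildeU.mul (contDiff_const.sub (contDiff_cutoff_smul r))

lemma cutoff_eq_zero {r : ℝ} (hr : 0 < r) {p : Pt 2} (hp : p ∉ ball (0 : Pt 2) (3 / 4 * r)) :
    cutoff (r⁻¹ • p) = 0 := by
  refine cutoff.zero_of_le_dist ?_
  rw [dist_zero_right, norm_smul, norm_inv, Real.norm_of_nonneg hr.le]
  rw [mem_ball_zero_iff, not_lt] at hp
  change 3 / 4 ≤ _
  rwa [inv_mul_eq_div, le_div_iff₀ hr]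

lemma cutU_eq_zero {r : ℝ} {p : Pt 2} (hp : r⁻¹ • p ∈ ball (0 : Pt 2) (1 / 2)) :
    cutU r p = 0 := by
  rw [cutU, cutoff.one_of_mem_closedBall (ball_subset_closedBall hp), sub_self, mul_zero]

lemma cutU_eq_tildeU {r : ℝ} (hr : 0 < r) {p : Pt 2} (hp : p ∉ ball (0 : Pt 2) r) :
    cutU r p = tildeU p := by
  rw [cutU, cutoff_eq_zero hr fun h => hp (ball_subset_ball (by linarith) h), sub_zero, mul_one]

lemma zeroExtGradL2_cutU_sub {r : ℝ} (hr : 0 < r) :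
    ZeroExtGradL2 2 (ball (0 : Pt 2) r) (fun x => cutU r x - tildeU x) := by
  refine zeroExtGradL2_of_contDiff ((contDiff_cutU r).sub contDiff_tildeU) ?_
    fun x hx => by rw [cutU_eq_tildeU hr hx, sub_self]
  refine HasCompactSupport.intro (isCompact_closedBall (0 : Pt 2) r) fun x hx => ?_
  rw [cutU_eq_tildeU hr fun h => hx (ball_subset_closedBall h), sub_self]

lemma cutU_nonneg {r : ℝ} {p : Pt 2} (hr : 0 < r) (hp : p ∈ dilate 2 r filledE) :
    0 ≤ cutU r p := by
  obtain hp | hp := hp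
  · have hE : p ∈ tildeE := dilate_tildeE hr ▸ hp
    exact mul_nonneg (le_of_lt hE) (sub_nonneg.2 cutoff.le_one)
  · exact (cutU_eq_zero (sqNW_union_sqSE_subset_ball hp)).ge

lemma cutU_nonpos {r : ℝ} {p : Pt 2} (hr : 0 < r) (hp : p ∉ dilate 2 r filledE) :
    cutU r p ≤ 0 := by
  have hE : p ∉ tildeE := fun h => hp (Or.inl (by rw [← dilate_tildeE hr] at h; exact h))
  exact mul_nonpos_of_nonpos_of_nonneg (not_lt.1 hE) (sub_nonneg.2 cutoff.le_one)

lemma cutU_eq_comp {r : ℝ} (hr : 0 < r) : cutU r = fun p => r ^ 2 * cutU 1 (r⁻¹ • p) := by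
  ext p
  simp only [cutU, tildeU, inv_one, one_smul, PiLp.smul_apply, smul_eq_mul]
  field_simp

lemma norm_gradient_cutU {r : ℝ} (hr : 0 < r) (p : Pt 2) :
    ‖gradient (cutU r) p‖ = r * ‖gradient (cutU 1) (r⁻¹ • p)‖ := by
  have hd : DifferentiableAt ℝ (cutU 1) (r⁻¹ • p) :=
    (contDiff_cutU 1).differentiable one_ne_zero _
  rw [norm_gradient, norm_gradient, cutU_eq_comp hr, fderiv_const_mul (by fun_prop),
    fderiv_comp_smul, smul_smul, norm_smul, norm_mul, norm_pow, norm_inv,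
    Real.norm_of_nonneg hr.le]
  congr 1
  field_simp

lemma setIntegral_gradient_cutU_le :
    ∃ C : ℝ, ∀ r : ℝ, 0 < r → ∫ p in ball (0 : Pt 2) r, ‖gradient (cutU r) p‖ ^ 2 ≤ C * r ^ 4 := by
  obtain ⟨M, hM⟩ := (isCompact_closedBall (0 : Pt 2) 1).exists_bound_of_continuousOn
    (continuous_gradient (contDiff_cutU 1)).continuousOn
  refine ⟨M ^ 2 * volume.real (ball (0 : Pt 2) 1), fun r hr => ?_⟩
  have hbound : ∀ p ∈ ball (0 : Pt 2) r, ‖‖gradient (cutU r) p‖ ^ 2‖ ≤ (r * M) ^ 2 := by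
    intro p hp
    rw [norm_pow, norm_norm, norm_gradient_cutU hr]
    have hp' : r⁻¹ • p ∈ ball (0 : Pt 2) 1 := by
      rw [← dilate_ball hr] at hp
      exact hp
    have := hM _ (ball_subset_closedBall hp')
    gcongr
  have h := norm_setIntegral_le_of_norm_le_const (μ := volume) measure_ball_lt_top hbound
  rw [measureReal_def, Measure.addHaar_ball _ _ hr.le, ENNReal.toReal_mul,
    ENNReal.toReal_ofReal (by positivity), finrank_euclideanSpace_fin, ← measureReal_def] at h
  refine ((le_abs_self _).trans h).trans_eq ?_
  ring

lemma admissiblePair_cutU {σ r : ℝ} (hr : 0 < r)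
    (hfin : fracPer 2 σ (dilate 2 r filledE) (ball 0 r) ≠ ∞) :
    AdmissiblePair 2 σ (ball (0 : Pt 2) r) (cutU r) (gradient (cutU r)) (dilate 2 r filledE) where
  locInt := (contDiff_cutU r).continuous.locallyIntegrable
  weakGrad := hasWeakGradOn_gradient (contDiff_cutU r) _
  dirichletFin := by
    have hcont : Continuous fun p => ‖gradient (cutU r) p‖ ^ 2 :=
      (continuous_gradient (contDiff_cutU r)).norm.pow 2
    have hloc : LocallyIntegrable (fun p => ‖gradient (cutU r) p‖ ^ 2) volume :=
      hcont.locallyIntegrable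
    exact (hloc.integrableOn_isCompact (isCompact_closedBall 0 r)).mono_set ball_subset_closedBall
  measE := measurableSet_filledE.preimage (measurable_const_smul _)
  perFin := hfin
  nonnegOnE := ae_of_all _ fun _ hx => cutU_nonneg hr hx
  nonposOffE := ae_of_all _ fun _ hx => cutU_nonpos hr hx

lemma dilate_filledE_sdiff_ball {r : ℝ} (hr : 0 < r) :
    dilate 2 r filledE \ ball (0 : Pt 2) r = tildeE \ ball (0 : Pt 2) r := by
  have hF : filledE \ ball (0 : Pt 2) 1 = tildeE \ ball (0 : Pt 2) 1 := by
    rw [filledE, union_sdiff_distrib, sdiff_eq_bot_iff.2 (sqNW_union_sqSE_subset_ball.trans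
      (ball_subset_ball (by norm_num)))]
    exact union_empty _
  rw [← dilate_ball hr]
  conv_rhs => rw [← dilate_tildeE hr]
  exact congrArg (dilate 2 r) hF

/-- A power of larger exponent is eventually dominated near `0`. -/

lemma eventually_mul_rpow_add_lt {a b C P Q γ : ℝ} (hab : b * γ < a) (hQ : 0 ≤ Q) (hQP : Q < P)
    (hγ : 0 < γ) :
    ∀ᶠ r : ℝ in 𝓝[>] 0, C * r ^ a + (r ^ b * Q) ^ γ < (r ^ b * P) ^ γ := by
  have hδ : 0 < P ^ γ - Q ^ γ := sub_pos.2 (Real.rpow_lt_rpow hQ hQP hγ)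
  have hlim : Tendsto (fun r : ℝ => C * r ^ (a - b * γ)) (𝓝[>] 0) (𝓝 0) := by
    have h := (Real.continuousAt_rpow_const 0 (a - b * γ) (Or.inr (sub_pos.2 hab).le)).tendsto
    rw [Real.zero_rpow (sub_pos.2 hab).ne'] at h
    simpa using (h.mono_left nhdsWithin_le_nhds).const_mul C
  filter_upwards [hlim.eventually (gt_mem_nhds hδ), self_mem_nhdsWithin] with r hr hr0
  have hr0 : 0 < r := hr0
  rw [Real.mul_rpow (by positivity) hQ, Real.mul_rpow (by positivity) (hQ.trans hQP.le),
    ← Real.rpow_mul hr0.le]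
  have hsplit : r ^ a = r ^ (b * γ) * r ^ (a - b * γ) := by
    rw [← Real.rpow_add hr0]; congr 1; ring
  rw [hsplit]
  have hpos : 0 < r ^ (b * γ) := by positivity
  nlinarith [mul_lt_mul_of_pos_left hr hpos]

/-- `(ũ, Ẽ)` is not minimal in small balls (Proposition 3.5). -/

theorem statement3 (σ : ℝ) (hσ : σ ∈ Set.Ioo (0 : ℝ) 1)
    (Φ : ℝ → ℝ) (γ : ℝ)
    (hmono : MonotoneOn Φ (Set.Ici 0))
    (hnonneg : ∀ t : ℝ, 0 ≤ t → 0 ≤ Φ t)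
    (hγ : γ ∈ Set.Ioo (0 : ℝ) (4 / (2 - σ)))
    (hΦγ : ∀ t ∈ Set.Icc (0 : ℝ) 1, Φ t = t ^ γ) :
    ∃ r_o : ℝ, 0 < r_o ∧
      ∀ r ∈ Set.Ioc (0 : ℝ) r_o,
        ∃ (v : Pt 2 → ℝ) (Gv : Pt 2 → Pt 2) (F : Set (Pt 2)),
          AdmissiblePair 2 σ (ball (0 : Pt 2) r) v Gv F ∧
          (∀ᵐ x ∂(volume : Measure (Pt 2)), x ∉ ball (0 : Pt 2) r → v x = tildeU x) ∧
          ZeroExtGradL2 2 (ball (0 : Pt 2) r) (fun x => v x - tildeU x) ∧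
          volume ((F \ ball (0 : Pt 2) r) ∆ (tildeE \ ball (0 : Pt 2) r)) = 0 ∧
          energyF 2 σ Φ (ball (0 : Pt 2) r) Gv F <
            energyF 2 σ Φ (ball (0 : Pt 2) r) tildeG tildeE := by
  obtain ⟨C, hC⟩ := setIntegral_gradient_cutU_le
  have hfin := fracPer_tildeE_ne_top hσ
  have hlt := fracPer_filledE_lt hfin
  set P := (fracPer 2 σ tildeE (ball 0 1)).toReal
  set Q := (fracPer 2 σ filledE (ball 0 1)).toReal
  have hQP : Q < P := (ENNReal.toReal_lt_toReal hlt.ne_top hfin).2 hlt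
  have hQ : 0 ≤ Q := ENNReal.toReal_nonneg
  have hσ2 : 0 < 2 - σ := by linarith [hσ.2]
  have hab : (2 - σ) * γ < 4 := by
    rw [mul_comm]
    exact (lt_div_iff₀ hσ2).1 hγ.2
  have hsmall : ∀ᶠ r : ℝ in 𝓝[>] 0, r ^ (2 - σ) * P < 1 := by
    have h := (Real.continuousAt_rpow_const 0 (2 - σ) (Or.inr hσ2.le)).tendsto
    rw [Real.zero_rpow hσ2.ne'] at h
    have h' : Tendsto (fun r : ℝ => r ^ (2 - σ) * P) (𝓝[>] 0) (𝓝 0) := by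
      simpa using (h.mono_left nhdsWithin_le_nhds).mul_const P
    exact h'.eventually (gt_mem_nhds one_pos)
  obtain ⟨r_o, hr_o, hsub⟩ := mem_nhdsGT_iff_exists_Ioc_subset.1
    (hsmall.and (eventually_mul_rpow_add_lt (C := C) hab hQ hQP hγ.1))
  refine ⟨r_o, hr_o, fun r hr => ?_⟩
  have hr0 : 0 < r := hr.1
  obtain ⟨hr1, hr2⟩ := hsub hr
  have hscale (E : Set (Pt 2)) (hE : MeasurableSet E) :
      fracPer 2 σ (dilate 2 r E) (ball 0 r) =
        ENNReal.ofReal (r ^ (2 - σ)) * fracPer 2 σ E (ball 0 1) := by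
    rw [← dilate_ball hr0]
    exact_mod_cast fracPer_dilate hr0 hE measurableSet_ball
  have hF := hscale filledE measurableSet_filledE
  have hE := hscale tildeE measurableSet_tildeE
  rw [dilate_tildeE hr0] at hE
  refine ⟨cutU r, gradient (cutU r), dilate 2 r filledE, admissiblePair_cutU hr0 ?_,
    ae_of_all _ fun x hx => cutU_eq_tildeU hr0 hx, zeroExtGradL2_cutU_sub hr0, ?_, ?_⟩
  · rw [hF]
    exact ENNReal.mul_ne_top ENNReal.ofReal_ne_top hlt.ne_top
  · rw [dilate_filledE_sdiff_ball hr0, symmDiff_self]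
    exact measure_empty
  · have hrpos : 0 ≤ r ^ (2 - σ) := by positivity
    have hle : r ^ (2 - σ) * Q ≤ r ^ (2 - σ) * P := by gcongr
    unfold energyF
    rw [hF, hE, ENNReal.toReal_mul, ENNReal.toReal_mul, ENNReal.toReal_ofReal hrpos,
      hΦγ _ ⟨by positivity, hle.trans hr1.le⟩, hΦγ _ ⟨by positivity, hr1.le⟩]
    have h1 := hC r hr0
    have h2 : 0 ≤ ∫ x in ball (0 : Pt 2) r, ‖tildeG x‖ ^ 2 := integral_nonneg fun _ => by positivity
    have h3 : r ^ (4 : ℝ) = r ^ 4 := by norm_cast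
    rw [h3] at hr2
    linarith
end
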